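/- For integers r₁,r₂ and 0<|q|<1, the two-variable false theta sum satisfies: q^{-2Q(r₁,r₂)/3} G_{((r₁+r₂)/3, (2r₂-r₁)/3)}(q) = Σ_{n₁≥0, n₂∈ℤ} ϱ(n₂, n₂+r₂) (-1)^{n₁} q^{n₁(n₁+1)/2 + n₁n₂ + 2n₂² + r₁n₁ + 2r₂n₂ + 2n₂ + r₂ + 1/2}, where G_λ is the p=2 series from the paper, Q(x,y)=x²+y²-xy, and ϱ(a,b)=(sgn*(a)+sgn*(b))/2. -/

import Mathlib

open Complex

def Qform (x y : ℚ) : ℚ := x ^ 2 + y ^ 2 - x * y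

/-- q^r for rational r, where q = e^{2πiτ}. -/
noncomputable def qpow (τ : ℂ) (r : ℚ) : ℂ := Complex.exp (2 * Real.pi * I * τ * r)

/-- ϱ(a,b) := (sgn*(a)+sgn*(b))/2 where sgn*(k)=1 if k≥0, -1 if k<0. -/
noncomputable def varrho (m n : ℤ) : ℂ :=
  ((if 0 ≤ m then (1 : ℂ) else -1) + (if 0 ≤ n then (1 : ℂ) else -1)) / 2

/-- The series G_lam for p=2 (from the paper). -/
noncomputable def Gser (τ : ℂ) (l₁ l₂ : ℚ) : ℂ :=
  ∑' n : ℕ × ℕ,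
    ((min (n.1 + 1) (n.2 + 1) : ℕ) : ℂ) *
      qpow τ (2 * Qform ((n.1 + 1 : ℕ) + l₁ - 1/2) ((n.2 + 1 : ℕ) + l₂ - 1/2)) *
      (1 - qpow τ (2 * ((n.1 + 1 : ℕ) + l₁) - ((n.2 + 1 : ℕ) + l₂))
         - qpow τ (2 * ((n.2 + 1 : ℕ) + l₂) - ((n.1 + 1 : ℕ) + l₁))
         + qpow τ (3 * ((n.1 + 1 : ℕ) + l₁))
         + qpow τ (3 * ((n.2 + 1 : ℕ) + l₂))
         - qpow τ (2 * ((n.1 + 1 : ℕ) + l₁) + 2 * ((n.2 + 1 : ℕ) + l₂)))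

namespace FT

lemma qpow_add (τ : ℂ) (a b : ℚ) : qpow τ (a + b) = qpow τ a * qpow τ b := by
  unfold qpow
  rw [← Complex.exp_add]
  push_cast
  ring_nf

lemma qpow_zero (τ : ℂ) : qpow τ 0 = 1 := by simp [qpow]

lemma norm_qpow (τ : ℂ) (a : ℚ) : ‖qpow τ a‖ = Real.exp (-(2 * Real.pi * τ.im) * a) := by
  unfold qpow
  rw [Complex.norm_exp]
  congr 1
  have : (2 * (Real.pi : ℂ) * I * τ * (a : ℂ)) = ((2 * Real.pi * a : ℝ) : ℂ) * (I * τ) := by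
    push_cast; ring
  rw [this, Complex.re_ofReal_mul]
  simp
  ring

/-- The exponent. -/
def eex (r₁ r₂ n k : ℤ) : ℚ :=
  (n : ℚ) * (n + 1) / 2 + n * k + 2 * (k : ℚ) ^ 2 + r₁ * n + 2 * r₂ * k + 2 * k + r₂ + 1/2

/-- The general term. -/
noncomputable def T (τ : ℂ) (r₁ r₂ n k : ℤ) : ℂ := (-1 : ℂ) ^ n * qpow τ (eex r₁ r₂ n k)

lemma norm_T (τ : ℂ) (r₁ r₂ n k : ℤ) :
    ‖T τ r₁ r₂ n k‖ = Real.exp (-(2 * Real.pi * τ.im) * (eex r₁ r₂ n k : ℚ)) := by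
  unfold T
  rw [norm_mul, norm_zpow, norm_qpow]
  simp

lemma quad_bound (c x : ℝ) (d : ℝ) (hd : 1 / 4 ≤ d) :
    d * x ^ 2 + c * x ≥ |x| - (|c| + 1) ^ 2 := by
  have h1 : c * x ≥ -(|c| * |x|) := by
    rw [← abs_mul]; exact neg_abs_le _
  have h2 : x ^ 2 = |x| ^ 2 := (sq_abs x).symm
  rw [h2]
  nlinarith [sq_nonneg (|x| / 2 - (|c| + 1)), sq_nonneg (|x|)]

lemma eex_bound (r₁ r₂ : ℤ) : ∃ K : ℝ, ∀ n k : ℤ,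
    |(n : ℝ)| + |(k : ℝ)| - K ≤ ((eex r₁ r₂ n k : ℚ) : ℝ) := by
  refine ⟨(|(r₁ : ℝ) + 1 / 2| + 1) ^ 2 + (|2 * (r₂ : ℝ) + 2| + 1) ^ 2 - r₂ - 1 / 2, ?_⟩
  intro n k
  have h1 := quad_bound ((r₁ : ℝ) + 1 / 2) n (1 / 4) le_rfl
  have h2 := quad_bound (2 * (r₂ : ℝ) + 2) k 1 (by norm_num)
  unfold eex
  push_cast
  nlinarith [sq_nonneg ((n : ℝ) / 2 + k)]

lemma summable_geo_nat (c : ℝ) (hc : 0 < c) :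
    Summable fun n : ℕ => (1 + (n : ℝ)) * Real.exp (-c * n) := by
  have h1 : ‖Real.exp (-c)‖ < 1 := by
    rw [Real.norm_eq_abs, abs_of_pos (Real.exp_pos _)]
    simpa using hc
  have h := (summable_pow_mul_geometric_of_norm_lt_one 0 h1).add
    (summable_pow_mul_geometric_of_norm_lt_one 1 h1)
  refine h.congr ?_
  intro n
  rw [← Real.exp_nat_mul]
  ring_nf

lemma summable_geo_int (c : ℝ) (hc : 0 < c) :
    Summable fun n : ℤ => (1 + |(n : ℝ)|) * Real.exp (-c * |(n : ℝ)|) := by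
  apply Summable.of_nat_of_neg
  · simpa using summable_geo_nat c hc
  · simpa using summable_geo_nat c hc

lemma summable_T (τ : ℂ) (hτ : 0 < τ.im) (r₁ r₂ : ℤ) :
    Summable fun p : ℤ × ℤ => (1 + |(p.2 : ℝ)|) * ‖T τ r₁ r₂ p.1 p.2‖ := by
  obtain ⟨K, hK⟩ := eex_bound r₁ r₂
  have hc : 0 < 2 * Real.pi * τ.im := by positivity
  set c := 2 * Real.pi * τ.im with hcdef
  have hg := summable_geo_int c hc
  have h := (hg.mul_of_nonneg hg (fun _ => by positivity) (fun _ => by positivity)).mul_left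
    (Real.exp (c * K))
  refine Summable.of_nonneg_of_le (fun _ => by positivity) ?_ h
  rintro ⟨n, k⟩
  rw [norm_T, ← hcdef]
  dsimp only
  have h1 : Real.exp (-c * ((eex r₁ r₂ n k : ℚ) : ℝ)) ≤
      Real.exp (c * K) * (Real.exp (-c * |(n : ℝ)|) * Real.exp (-c * |(k : ℝ)|)) := by
    rw [← Real.exp_add, ← Real.exp_add]
    apply Real.exp_le_exp.mpr
    nlinarith [hK n k]
  calc (1 + |(k : ℝ)|) * Real.exp (-c * ((eex r₁ r₂ n k : ℚ) : ℝ))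
      ≤ (1 + |(k : ℝ)|) *
        (Real.exp (c * K) * (Real.exp (-c * |(n : ℝ)|) * Real.exp (-c * |(k : ℝ)|))) := by gcongr
    _ ≤ (1 + |(n : ℝ)|) * ((1 + |(k : ℝ)|) *
        (Real.exp (c * K) * (Real.exp (-c * |(n : ℝ)|) * Real.exp (-c * |(k : ℝ)|)))) := by
        apply le_mul_of_one_le_left (by positivity)
        linarith [abs_nonneg (n : ℝ)]
    _ = _ := by ring

/-- Weighted summability along an injective reindexing. -/
lemma summable_w (τ : ℂ) (hτ : 0 < τ.im) (r₁ r₂ : ℤ) {α : Type*} (g : α → ℤ × ℤ)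
    (hg : Function.Injective g) (w : α → ℂ) (M : ℝ)
    (hw : ∀ x, ‖w x‖ ≤ M * (1 + |((g x).2 : ℝ)|)) :
    Summable fun x => w x * T τ r₁ r₂ (g x).1 (g x).2 := by
  have h := ((summable_T τ hτ r₁ r₂).comp_injective hg).mul_left M
  refine Summable.of_norm_bounded h ?_
  intro x
  rw [norm_mul]
  calc _ ≤ M * (1 + |((g x).2 : ℝ)|) * ‖T τ r₁ r₂ (g x).1 (g x).2‖ := by
        gcongr; exact hw x
    _ = _ := by simp [mul_assoc]

lemma summable_T' (τ : ℂ) (hτ : 0 < τ.im) (r₁ r₂ : ℤ) {α : Type*} (g : α → ℤ × ℤ)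
    (hg : Function.Injective g) :
    Summable fun x => T τ r₁ r₂ (g x).1 (g x).2 := by
  have := summable_w τ hτ r₁ r₂ g hg (fun _ => 1) 1 (fun x => by simp)
  simpa using this

lemma tsum_ite_inj {α β : Type*} (g : α → β) (hg : Function.Injective g) (P : β → Prop)
    [DecidablePred P] (hP : ∀ x, P x ↔ x ∈ Set.range g) (f : β → ℂ) :
    ∑' x, (if P x then f x else 0) = ∑' y, f (g y) := by
  rw [← hg.tsum_eq]
  · refine tsum_congr fun y => ?_
    rw [if_pos ((hP _).2 ⟨y, rfl⟩)]
  · intro x hx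
    rw [← hP]
    by_contra h
    simp [h] at hx

lemma summable_ite {β : Type*} (P : β → Prop) [DecidablePred P] (f : β → ℂ) (hf : Summable f) :
    Summable fun x => if P x then f x else 0 := by
  have := hf.indicator {x | P x}
  refine this.congr ?_
  intro x
  simp [Set.indicator]

lemma tsum_ge (f : ℕ × ℕ → ℂ) :
    ∑' p : ℕ × ℕ, (if p.2 ≤ p.1 then f p else 0) = ∑' p : ℕ × ℕ, f (p.2 + p.1, p.2) := by
  apply tsum_ite_inj (fun p : ℕ × ℕ => (p.2 + p.1, p.2))
  · rintro ⟨a, b⟩ ⟨c, d⟩ h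
    simp only [Prod.mk.injEq] at h ⊢
    omega
  · rintro ⟨a, b⟩
    simp only [Set.mem_range, Prod.mk.injEq, Prod.exists]
    constructor
    · intro h; exact ⟨a - b, b, by omega, rfl⟩
    · rintro ⟨c, d, h1, h2⟩; omega

lemma tsum_le' (f : ℕ × ℕ → ℂ) :
    ∑' p : ℕ × ℕ, (if p.1 ≤ p.2 then f p else 0) = ∑' p : ℕ × ℕ, f (p.2, p.2 + p.1) := by
  apply tsum_ite_inj (fun p : ℕ × ℕ => (p.2, p.2 + p.1))
  · rintro ⟨a, b⟩ ⟨c, d⟩ h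
    simp only [Prod.mk.injEq] at h ⊢
    omega
  · rintro ⟨a, b⟩
    simp only [Set.mem_range, Prod.mk.injEq, Prod.exists]
    constructor
    · intro h; exact ⟨b - a, a, rfl, by omega⟩
    · rintro ⟨c, d, h1, h2⟩; omega

lemma tsum_lt' (f : ℕ × ℕ → ℂ) :
    ∑' p : ℕ × ℕ, (if p.1 < p.2 then f p else 0) = ∑' p : ℕ × ℕ, f (p.2, p.2 + p.1 + 1) := by
  apply tsum_ite_inj (fun p : ℕ × ℕ => (p.2, p.2 + p.1 + 1))
  · rintro ⟨a, b⟩ ⟨c, d⟩ h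
    simp only [Prod.mk.injEq] at h ⊢
    omega
  · rintro ⟨a, b⟩
    simp only [Set.mem_range, Prod.mk.injEq, Prod.exists]
    constructor
    · intro h; exact ⟨b - a - 1, a, rfl, by omega⟩
    · rintro ⟨c, d, h1, h2⟩; omega

/-- Telescoping for the diagonal direction. -/
lemma tele_A (A : ℕ → ℕ → ℂ)
    (h1 : Summable fun p : ℕ × ℕ => ((min (p.1 + 1) (p.2 + 1) : ℕ) : ℂ) * A p.1 p.2)
    (h2 : Summable fun p : ℕ × ℕ => A p.1 p.2) :
    ∑' p : ℕ × ℕ, ((min (p.1 + 1) (p.2 + 1) : ℕ) : ℂ) * A p.1 p.2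
      - ∑' p : ℕ × ℕ, ((min (p.1 + 1) (p.2 + 1) : ℕ) : ℂ) * A (p.1 + 1) (p.2 + 1)
      = ∑' p : ℕ × ℕ, A (p.2 + p.1) p.2 + ∑' p : ℕ × ℕ, A p.2 (p.2 + p.1 + 1) := by
  have e : ∑' p : ℕ × ℕ, ((min (p.1 + 1) (p.2 + 1) : ℕ) : ℂ) * A (p.1 + 1) (p.2 + 1)
      = ∑' p : ℕ × ℕ, ((min p.1 p.2 : ℕ) : ℂ) * A p.1 p.2 := by
    have hinj : Function.Injective (fun p : ℕ × ℕ => (p.1 + 1, p.2 + 1)) := by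
      rintro ⟨a, b⟩ ⟨c, d⟩ h
      simp only [Prod.mk.injEq] at h ⊢
      omega
    rw [← hinj.tsum_eq (f := fun p : ℕ × ℕ => ((min p.1 p.2 : ℕ) : ℂ) * A p.1 p.2)]
    rintro ⟨a, b⟩ hx
    rcases a with _ | a
    · simp at hx
    rcases b with _ | b
    · simp at hx
    exact ⟨(a, b), rfl⟩
  have h3 : Summable fun p : ℕ × ℕ => ((min p.1 p.2 : ℕ) : ℂ) * A p.1 p.2 := by
    refine (h1.sub h2).congr ?_
    intro p
    rw [Nat.add_min_add_right]
    push_cast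
    ring
  rw [e, ← h1.tsum_sub h3, ← tsum_ge (fun p => A p.1 p.2), ← tsum_lt' (fun p => A p.1 p.2),
    ← (summable_ite _ _ h2).tsum_add (summable_ite _ _ h2)]
  refine tsum_congr ?_
  rintro ⟨a, b⟩
  rw [Nat.add_min_add_right]
  dsimp only
  rcases le_or_gt b a with h | h
  · rw [if_pos h, if_neg (by omega)]; push_cast; ring
  · rw [if_neg (by omega), if_pos h]; push_cast; ring

lemma tele_B (B : ℕ → ℕ → ℂ)
    (h1 : Summable fun p : ℕ × ℕ => ((min (p.1 + 1) (p.2 + 1) : ℕ) : ℂ) * B p.1 p.2)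
    (h2 : Summable fun p : ℕ × ℕ => B p.1 p.2) :
    ∑' p : ℕ × ℕ, ((min (p.1 + 1) (p.2 + 1) : ℕ) : ℂ) * B p.1 p.2
      - ∑' p : ℕ × ℕ, ((min (p.1 + 1) (p.2 + 1) : ℕ) : ℂ) * B p.1 (p.2 + 1)
      = ∑' p : ℕ × ℕ, B (p.2 + p.1) p.2 := by
  have e : ∑' p : ℕ × ℕ, ((min (p.1 + 1) (p.2 + 1) : ℕ) : ℂ) * B p.1 (p.2 + 1)
      = ∑' p : ℕ × ℕ, ((min (p.1 + 1) p.2 : ℕ) : ℂ) * B p.1 p.2 := by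
    have hinj : Function.Injective (fun p : ℕ × ℕ => (p.1, p.2 + 1)) := by
      rintro ⟨a, b⟩ ⟨c, d⟩ h
      simp only [Prod.mk.injEq] at h ⊢
      omega
    rw [← hinj.tsum_eq (f := fun p : ℕ × ℕ => ((min (p.1 + 1) p.2 : ℕ) : ℂ) * B p.1 p.2)]
    rintro ⟨a, b⟩ hx
    rcases b with _ | b
    · simp at hx
    exact ⟨(a, b), rfl⟩
  have key : ∀ p : ℕ × ℕ, ((min (p.1 + 1) (p.2 + 1) : ℕ) : ℂ) * B p.1 p.2
      - (if p.2 ≤ p.1 then B p.1 p.2 else 0) = ((min (p.1 + 1) p.2 : ℕ) : ℂ) * B p.1 p.2 := by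
    rintro ⟨a, b⟩
    dsimp only
    rcases le_or_gt b a with h | h
    · rw [if_pos h, min_eq_right (by omega), min_eq_right (by omega)]; push_cast; ring
    · rw [if_neg (by omega), min_eq_left (by omega), min_eq_left (by omega)]; push_cast; ring
  have h4 := summable_ite (fun p : ℕ × ℕ => p.2 ≤ p.1) _ h2
  rw [e, ← tsum_ge (fun p => B p.1 p.2), ← tsum_congr key, h1.tsum_sub h4]
  ring

lemma tele_C (C : ℕ → ℕ → ℂ)
    (h1 : Summable fun p : ℕ × ℕ => ((min (p.1 + 1) (p.2 + 1) : ℕ) : ℂ) * C p.1 p.2)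
    (h2 : Summable fun p : ℕ × ℕ => C p.1 p.2) :
    ∑' p : ℕ × ℕ, ((min (p.1 + 1) (p.2 + 1) : ℕ) : ℂ) * C p.1 p.2
      - ∑' p : ℕ × ℕ, ((min (p.1 + 1) (p.2 + 1) : ℕ) : ℂ) * C (p.1 + 1) p.2
      = ∑' p : ℕ × ℕ, C p.2 (p.2 + p.1) := by
  have e : ∑' p : ℕ × ℕ, ((min (p.1 + 1) (p.2 + 1) : ℕ) : ℂ) * C (p.1 + 1) p.2
      = ∑' p : ℕ × ℕ, ((min p.1 (p.2 + 1) : ℕ) : ℂ) * C p.1 p.2 := by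
    have hinj : Function.Injective (fun p : ℕ × ℕ => (p.1 + 1, p.2)) := by
      rintro ⟨a, b⟩ ⟨c, d⟩ h
      simp only [Prod.mk.injEq] at h ⊢
      omega
    rw [← hinj.tsum_eq (f := fun p : ℕ × ℕ => ((min p.1 (p.2 + 1) : ℕ) : ℂ) * C p.1 p.2)]
    rintro ⟨a, b⟩ hx
    rcases a with _ | a
    · simp at hx
    exact ⟨(a, b), rfl⟩
  have key : ∀ p : ℕ × ℕ, ((min (p.1 + 1) (p.2 + 1) : ℕ) : ℂ) * C p.1 p.2
      - (if p.1 ≤ p.2 then C p.1 p.2 else 0) = ((min p.1 (p.2 + 1) : ℕ) : ℂ) * C p.1 p.2 := by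
    rintro ⟨a, b⟩
    dsimp only
    rcases le_or_gt a b with h | h
    · rw [if_pos h, min_eq_left (by omega), min_eq_left (by omega)]; push_cast; ring
    · rw [if_neg (by omega), min_eq_right (by omega), min_eq_right (by omega)]; push_cast; ring
  have h4 := summable_ite (fun p : ℕ × ℕ => p.1 ≤ p.2) _ h2
  rw [e, ← tsum_le' (fun p => C p.1 p.2), ← tsum_congr key, h1.tsum_sub h4]
  ring

/-- Vanishing of the full theta sum. -/
lemma theta_zero (τ : ℂ) (r₁ r₂ k : ℤ) : ∑' n : ℤ, T τ r₁ r₂ n k = 0 := by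
  have h : ∑' n : ℤ, T τ r₁ r₂ n k = - ∑' n : ℤ, T τ r₁ r₂ n k := by
    rw [← tsum_neg]
    rw [← (Equiv.subLeft (-1 - 2 * (k + r₁) : ℤ)).tsum_eq]
    refine tsum_congr fun n => ?_
    simp only [Equiv.subLeft_apply]
    unfold T
    have h1 : eex r₁ r₂ (-1 - 2 * (k + r₁) - n) k = eex r₁ r₂ n k := by
      unfold eex; push_cast; ring
    have h2 : (-1 : ℂ) ^ (-1 - 2 * (k + r₁) - n) = -(-1 : ℂ) ^ n := by
      rcases Int.even_or_odd n with hn | hn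
      · rw [hn.neg_one_zpow, Odd.neg_one_zpow]
        obtain ⟨c, rfl⟩ := hn
        exact ⟨-1 - (k + r₁) - c, by ring⟩
      · rw [hn.neg_one_zpow, Even.neg_one_zpow]
        · simp
        obtain ⟨c, rfl⟩ := hn
        exact ⟨-1 - (k + r₁) - c, by ring⟩
    rw [h1, h2]
    ring
  exact self_eq_neg.mp h

lemma even_odd (f : ℕ → ℕ → ℂ) (hf : Summable fun p : ℕ × ℕ => f p.1 p.2) :
    ∑' p : ℕ × ℕ, f (2 * p.1) p.2 + ∑' p : ℕ × ℕ, f (2 * p.1 + 1) p.2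
      = ∑' p : ℕ × ℕ, f p.1 p.2 := by
  have i0 : Function.Injective (fun p : ℕ × ℕ => (2 * p.1, p.2)) := by
    rintro ⟨a, b⟩ ⟨c, d⟩ h
    simp only [Prod.mk.injEq] at h ⊢
    omega
  have i1 : Function.Injective (fun p : ℕ × ℕ => (2 * p.1 + 1, p.2)) := by
    rintro ⟨a, b⟩ ⟨c, d⟩ h
    simp only [Prod.mk.injEq] at h ⊢
    omega
  have e0 := tsum_ite_inj _ i0 (fun p => p.1 % 2 = 0) (by
    rintro ⟨a, b⟩
    simp only [Set.mem_range, Prod.mk.injEq, Prod.exists]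
    constructor
    · intro h; exact ⟨a / 2, b, by omega, rfl⟩
    · rintro ⟨c, d, h1, h2⟩; omega) (fun p => f p.1 p.2)
  have e1 := tsum_ite_inj _ i1 (fun p => p.1 % 2 = 1) (by
    rintro ⟨a, b⟩
    simp only [Set.mem_range, Prod.mk.injEq, Prod.exists]
    constructor
    · intro h; exact ⟨a / 2, b, by omega, rfl⟩
    · rintro ⟨c, d, h1, h2⟩; omega) (fun p => f p.1 p.2)
  dsimp only at e0 e1
  rw [← e0, ← e1, ← (summable_ite _ _ hf).tsum_add (summable_ite _ _ hf)]
  refine tsum_congr fun p => ?_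
  rcases Nat.mod_two_eq_zero_or_one p.1 with h | h <;> simp [h]

lemma T_even (τ : ℂ) (r₁ r₂ n k : ℤ) (hn : Even n) :
    T τ r₁ r₂ n k = qpow τ (eex r₁ r₂ n k) := by
  unfold T; rw [hn.neg_one_zpow, one_mul]

lemma T_odd (τ : ℂ) (r₁ r₂ n k : ℤ) (hn : Odd n) :
    T τ r₁ r₂ n k = -qpow τ (eex r₁ r₂ n k) := by
  unfold T; rw [hn.neg_one_zpow, neg_one_mul]

/-- The summand of G as a combination of six `T` terms. -/
lemma term_eq (τ : ℂ) (r₁ r₂ : ℤ) (i j : ℕ) (w : ℂ) :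
    qpow τ (-(2 * Qform (r₁ : ℚ) (r₂ : ℚ)) / 3) *
    (w * qpow τ (2 * Qform ((i + 1 : ℕ) + ((r₁ : ℚ) + r₂) / 3 - 1/2)
        ((j + 1 : ℕ) + (2 * (r₂ : ℚ) - r₁) / 3 - 1/2)) *
      (1 - qpow τ (2 * ((i + 1 : ℕ) + ((r₁ : ℚ) + r₂) / 3) - ((j + 1 : ℕ) + (2 * (r₂ : ℚ) - r₁) / 3))
         - qpow τ (2 * ((j + 1 : ℕ) + (2 * (r₂ : ℚ) - r₁) / 3) - ((i + 1 : ℕ) + ((r₁ : ℚ) + r₂) / 3))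
         + qpow τ (3 * ((i + 1 : ℕ) + ((r₁ : ℚ) + r₂) / 3))
         + qpow τ (3 * ((j + 1 : ℕ) + (2 * (r₂ : ℚ) - r₁) / 3))
         - qpow τ (2 * ((i + 1 : ℕ) + ((r₁ : ℚ) + r₂) / 3)
            + 2 * ((j + 1 : ℕ) + (2 * (r₂ : ℚ) - r₁) / 3))))
    = (w * T τ r₁ r₂ (2 * ((i : ℤ) - j)) j
        - w * T τ r₁ r₂ (2 * (((i + 1 : ℕ) : ℤ) - (j + 1 : ℕ))) (j + 1 : ℕ))
      + (w * T τ r₁ r₂ (2 * ((i : ℤ) - j) + 1) j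
        - w * T τ r₁ r₂ (2 * ((i : ℤ) - (j + 1 : ℕ)) + 1) (j + 1 : ℕ))
      + (w * T τ r₁ r₂ (2 * ((i : ℤ) - j) - 1) (-r₂ - 1 - i)
        - w * T τ r₁ r₂ (2 * (((i + 1 : ℕ) : ℤ) - j) - 1) (-r₂ - 1 - (i + 1 : ℕ))) := by
  rw [T_even _ _ _ _ _ ⟨(i : ℤ) - j, by ring⟩,
    T_even _ _ _ _ _ ⟨((i + 1 : ℕ) : ℤ) - (j + 1 : ℕ), by ring⟩,
    T_odd _ _ _ _ _ ⟨(i : ℤ) - j, by ring⟩,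
    T_odd _ _ _ _ _ ⟨(i : ℤ) - (j + 1 : ℕ), by ring⟩,
    T_odd _ _ _ _ _ ⟨(i : ℤ) - j - 1, by ring⟩,
    T_odd _ _ _ _ _ ⟨((i + 1 : ℕ) : ℤ) - j - 1, by ring⟩]
  set X := -(2 * Qform (r₁ : ℚ) (r₂ : ℚ)) / 3 with hX
  set Y := 2 * Qform ((i + 1 : ℕ) + ((r₁ : ℚ) + r₂) / 3 - 1/2)
        ((j + 1 : ℕ) + (2 * (r₂ : ℚ) - r₁) / 3 - 1/2) with hY
  have e1 : eex r₁ r₂ (2 * ((i : ℤ) - j)) j = X + Y := by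
    rw [hX, hY]; unfold eex Qform; push_cast; ring
  have e2 : eex r₁ r₂ (2 * (((i + 1 : ℕ) : ℤ) - (j + 1 : ℕ))) (j + 1 : ℕ) = X + Y +
      (2 * ((i + 1 : ℕ) + ((r₁ : ℚ) + r₂) / 3)
            + 2 * ((j + 1 : ℕ) + (2 * (r₂ : ℚ) - r₁) / 3)) := by
    rw [hX, hY]; unfold eex Qform; push_cast; ring
  have e3 : eex r₁ r₂ (2 * ((i : ℤ) - j) + 1) j = X + Y +
      (2 * ((i + 1 : ℕ) + ((r₁ : ℚ) + r₂) / 3) - ((j + 1 : ℕ) + (2 * (r₂ : ℚ) - r₁) / 3)) := by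
    rw [hX, hY]; unfold eex Qform; push_cast; ring
  have e4 : eex r₁ r₂ (2 * ((i : ℤ) - (j + 1 : ℕ)) + 1) (j + 1 : ℕ) = X + Y +
      (3 * ((j + 1 : ℕ) + (2 * (r₂ : ℚ) - r₁) / 3)) := by
    rw [hX, hY]; unfold eex Qform; push_cast; ring
  have e5 : eex r₁ r₂ (2 * ((i : ℤ) - j) - 1) (-r₂ - 1 - i) = X + Y +
      (2 * ((j + 1 : ℕ) + (2 * (r₂ : ℚ) - r₁) / 3) - ((i + 1 : ℕ) + ((r₁ : ℚ) + r₂) / 3)) := by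
    rw [hX, hY]; unfold eex Qform; push_cast; ring
  have e6 : eex r₁ r₂ (2 * (((i + 1 : ℕ) : ℤ) - j) - 1) (-r₂ - 1 - (i + 1 : ℕ)) = X + Y +
      (3 * ((i + 1 : ℕ) + ((r₁ : ℚ) + r₂) / 3)) := by
    rw [hX, hY]; unfold eex Qform; push_cast; ring
  rw [e1, e2, e3, e4, e5, e6]
  simp only [qpow_add τ (X + Y), qpow_add τ X Y]
  ring

lemma T_flip (τ : ℂ) (r₁ r₂ : ℤ) (a b : ℤ) :
    T τ r₁ r₂ (2 * (a - b)) b = T τ r₁ r₂ (2 * (a - b)) (-r₂ - 1 - a) := by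
  unfold T
  congr 2
  unfold eex
  push_cast
  ring

lemma norm_min_le (a b : ℕ) : ‖((min (a + 1) (b + 1) : ℕ) : ℂ)‖ ≤ 1 + (b : ℝ) := by
  rw [Complex.norm_natCast]
  have : min (a + 1) (b + 1) ≤ b + 1 := min_le_right _ _
  have h : ((min (a + 1) (b + 1) : ℕ) : ℝ) ≤ ((b + 1 : ℕ) : ℝ) := by exact_mod_cast this
  push_cast at h ⊢
  linarith

lemma norm_min_le' (a b : ℕ) (r : ℤ) : ‖((min (a + 1) (b + 1) : ℕ) : ℂ)‖ ≤
    (2 + |(r : ℝ)|) * (1 + |((-r - 1 - (a : ℤ) : ℤ) : ℝ)|) := by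
  rw [Complex.norm_natCast]
  have : min (a + 1) (b + 1) ≤ a + 1 := min_le_left _ _
  have h : ((min (a + 1) (b + 1) : ℕ) : ℝ) ≤ ((a + 1 : ℕ) : ℝ) := by exact_mod_cast this
  have h3 : ((-r - 1 - (a : ℤ) : ℤ) : ℝ) = -((r : ℝ) + 1 + a) := by push_cast; ring
  rw [h3, abs_neg]
  have h4 := le_abs_self ((r : ℝ) + 1 + a)
  have h5 := neg_abs_le (r : ℝ)
  have h6 := abs_nonneg (r : ℝ)
  have h7 := abs_nonneg ((r : ℝ) + 1 + a)
  refine h.trans ?_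
  push_cast
  nlinarith [mul_nonneg h6 h7]

/-- The left-hand side as two plain sums. -/
lemma lhs_eq (τ : ℂ) (hτ : 0 < τ.im) (r₁ r₂ : ℤ) :
    qpow τ (-(2 * Qform (r₁ : ℚ) (r₂ : ℚ)) / 3) *
      Gser τ (((r₁ : ℚ) + r₂) / 3) ((2 * (r₂ : ℚ) - r₁) / 3)
    = ∑' p : ℕ × ℕ, T τ r₁ r₂ p.1 p.2
      + ∑' p : ℕ × ℕ, T τ r₁ r₂ (-((p.1 : ℤ) + 1)) (-r₂ - 1 - p.2) := by
  unfold Gser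
  rw [← tsum_mul_left]
  rw [tsum_congr (fun p : ℕ × ℕ => term_eq τ r₁ r₂ p.1 p.2 _)]
  let A : ℕ → ℕ → ℂ := fun i j => T τ r₁ r₂ (2 * ((i : ℤ) - j)) j
  let B : ℕ → ℕ → ℂ := fun i j => T τ r₁ r₂ (2 * ((i : ℤ) - j) + 1) j
  let C : ℕ → ℕ → ℂ := fun i j => T τ r₁ r₂ (2 * ((i : ℤ) - j) - 1) (-r₂ - 1 - i)
  have iA : Function.Injective (fun p : ℕ × ℕ => ((2 * ((p.1 : ℤ) - p.2), (p.2 : ℤ)) : ℤ × ℤ)) := by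
    rintro ⟨a, b⟩ ⟨c, d⟩ h
    simp only [Prod.mk.injEq] at h ⊢
    omega
  have iB : Function.Injective
      (fun p : ℕ × ℕ => ((2 * ((p.1 : ℤ) - p.2) + 1, (p.2 : ℤ)) : ℤ × ℤ)) := by
    rintro ⟨a, b⟩ ⟨c, d⟩ h
    simp only [Prod.mk.injEq] at h ⊢
    omega
  have iC : Function.Injective
      (fun p : ℕ × ℕ => ((2 * ((p.1 : ℤ) - p.2) - 1, -r₂ - 1 - (p.1 : ℤ)) : ℤ × ℤ)) := by
    rintro ⟨a, b⟩ ⟨c, d⟩ h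
    simp only [Prod.mk.injEq] at h ⊢
    omega
  have sA : Summable fun p : ℕ × ℕ => A p.1 p.2 := by
    have := summable_T' τ hτ r₁ r₂ _ iA
    exact this
  have sB : Summable fun p : ℕ × ℕ => B p.1 p.2 := by
    have := summable_T' τ hτ r₁ r₂ _ iB
    exact this
  have sC : Summable fun p : ℕ × ℕ => C p.1 p.2 := by
    have := summable_T' τ hτ r₁ r₂ _ iC
    exact this
  have wA : Summable fun p : ℕ × ℕ => ((min (p.1 + 1) (p.2 + 1) : ℕ) : ℂ) * A p.1 p.2 := by
    have := summable_w τ hτ r₁ r₂ _ iA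
      (fun p : ℕ × ℕ => ((min (p.1 + 1) (p.2 + 1) : ℕ) : ℂ)) 1 (fun p => by simpa using norm_min_le p.1 p.2)
    exact this
  have wB : Summable fun p : ℕ × ℕ => ((min (p.1 + 1) (p.2 + 1) : ℕ) : ℂ) * B p.1 p.2 := by
    have := summable_w τ hτ r₁ r₂ _ iB
      (fun p : ℕ × ℕ => ((min (p.1 + 1) (p.2 + 1) : ℕ) : ℂ)) 1 (fun p => by simpa using norm_min_le p.1 p.2)
    exact this
  have wC : Summable fun p : ℕ × ℕ => ((min (p.1 + 1) (p.2 + 1) : ℕ) : ℂ) * C p.1 p.2 := by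
    have := summable_w τ hτ r₁ r₂ _ iC
      (fun p : ℕ × ℕ => ((min (p.1 + 1) (p.2 + 1) : ℕ) : ℂ)) (2 + |(r₂ : ℝ)|) (fun p => norm_min_le' p.1 p.2 r₂)
    exact this
  have jA : Function.Injective (fun p : ℕ × ℕ =>
      ((2 * (((p.1 + 1 : ℕ) : ℤ) - (p.2 + 1 : ℕ)), ((p.2 + 1 : ℕ) : ℤ)) : ℤ × ℤ)) := by
    rintro ⟨a, b⟩ ⟨c, d⟩ h
    simp only [Prod.mk.injEq] at h ⊢
    omega
  have jB : Function.Injective (fun p : ℕ × ℕ =>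
      ((2 * ((p.1 : ℤ) - (p.2 + 1 : ℕ)) + 1, ((p.2 + 1 : ℕ) : ℤ)) : ℤ × ℤ)) := by
    rintro ⟨a, b⟩ ⟨c, d⟩ h
    simp only [Prod.mk.injEq] at h ⊢
    omega
  have jC : Function.Injective (fun p : ℕ × ℕ =>
      ((2 * (((p.1 + 1 : ℕ) : ℤ) - p.2) - 1, -r₂ - 1 - ((p.1 + 1 : ℕ) : ℤ)) : ℤ × ℤ)) := by
    rintro ⟨a, b⟩ ⟨c, d⟩ h
    simp only [Prod.mk.injEq] at h ⊢
    omega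
  have bnd : ∀ p : ℕ × ℕ, ‖((min (p.1 + 1) (p.2 + 1) : ℕ) : ℂ)‖ ≤
      1 * (1 + |(((p.2 + 1 : ℕ) : ℤ) : ℝ)|) := by
    intro p
    refine (norm_min_le p.1 p.2).trans ?_
    rw [Int.cast_natCast, Nat.abs_cast]
    push_cast
    linarith
  have vA : Summable fun p : ℕ × ℕ =>
      ((min (p.1 + 1) (p.2 + 1) : ℕ) : ℂ) * A (p.1 + 1) (p.2 + 1) := by
    have := summable_w τ hτ r₁ r₂ _ jA
      (fun p : ℕ × ℕ => ((min (p.1 + 1) (p.2 + 1) : ℕ) : ℂ)) 1 bnd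
    exact this
  have vB : Summable fun p : ℕ × ℕ =>
      ((min (p.1 + 1) (p.2 + 1) : ℕ) : ℂ) * B p.1 (p.2 + 1) := by
    have := summable_w τ hτ r₁ r₂ _ jB
      (fun p : ℕ × ℕ => ((min (p.1 + 1) (p.2 + 1) : ℕ) : ℂ)) 1 bnd
    exact this
  have vC : Summable fun p : ℕ × ℕ =>
      ((min (p.1 + 1) (p.2 + 1) : ℕ) : ℂ) * C (p.1 + 1) p.2 := by
    have := summable_w τ hτ r₁ r₂ _ jC
      (fun p : ℕ × ℕ => ((min (p.1 + 1) (p.2 + 1) : ℕ) : ℂ)) (2 + |(r₂ : ℝ)|) (fun p => by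
        refine le_trans ?_ (norm_min_le' (p.1 + 1) p.2 r₂)
        rw [Complex.norm_natCast, Complex.norm_natCast]
        exact_mod_cast (min_le_min_right _ (by omega) : min (p.1 + 1) (p.2 + 1) ≤ _))
    exact this
  have tA := tele_A A wA sA
  have tB := tele_B B wB sB
  have tC := tele_C C wC sC
  have main := ((wA.sub vA).add (wB.sub vB)).tsum_add (wC.sub vC)
  rw [(wA.sub vA).tsum_add (wB.sub vB), wA.tsum_sub vA, wB.tsum_sub vB, wC.tsum_sub vC,
    tA, tB, tC] at main
  refine main.trans ?_
  have kP : Function.Injective (fun p : ℕ × ℕ => (((p.1 : ℤ), (p.2 : ℤ)) : ℤ × ℤ)) := by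
    rintro ⟨a, b⟩ ⟨c, d⟩ h
    simp only [Prod.mk.injEq] at h ⊢
    omega
  have kN : Function.Injective
      (fun p : ℕ × ℕ => ((-((p.1 : ℤ) + 1), -r₂ - 1 - (p.2 : ℤ)) : ℤ × ℤ)) := by
    rintro ⟨a, b⟩ ⟨c, d⟩ h
    simp only [Prod.mk.injEq] at h ⊢
    omega
  have sP := summable_T' τ hτ r₁ r₂ _ kP
  have sN := summable_T' τ hτ r₁ r₂ _ kN
  rw [← even_odd (fun n k => T τ r₁ r₂ n k) sP,
    ← even_odd (fun n k => T τ r₁ r₂ (-((n : ℤ) + 1)) (-r₂ - 1 - (k : ℤ))) sN]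
  have q1 : ∀ p : ℕ × ℕ, A (p.2 + p.1) p.2 = T τ r₁ r₂ ((2 * p.1 : ℕ) : ℤ) p.2 := by
    intro p
    show T τ r₁ r₂ _ _ = _
    congr 1; push_cast; ring
  have q2 : ∀ p : ℕ × ℕ, A p.2 (p.2 + p.1 + 1)
      = T τ r₁ r₂ (-(((2 * p.1 + 1 : ℕ) : ℤ) + 1)) (-r₂ - 1 - p.2) := by
    intro p
    show T τ r₁ r₂ _ _ = _
    rw [T_flip]
    congr 1; push_cast; ring
  have q3 : ∀ p : ℕ × ℕ, B (p.2 + p.1) p.2 = T τ r₁ r₂ ((2 * p.1 + 1 : ℕ) : ℤ) p.2 := by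
    intro p
    show T τ r₁ r₂ _ _ = _
    congr 1; push_cast; ring
  have q4 : ∀ p : ℕ × ℕ, C p.2 (p.2 + p.1)
      = T τ r₁ r₂ (-(((2 * p.1 : ℕ) : ℤ) + 1)) (-r₂ - 1 - p.2) := by
    intro p
    show T τ r₁ r₂ _ _ = _
    congr 1; push_cast; ring
  rw [tsum_congr q1, tsum_congr q2, tsum_congr q3, tsum_congr q4]
  ring

lemma neg_part (τ : ℂ) (hτ : 0 < τ.im) (r₁ r₂ : ℤ) :
    ∑' p : ℕ × ℕ, T τ r₁ r₂ p.1 (-r₂ - 1 - p.2)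
      + ∑' p : ℕ × ℕ, T τ r₁ r₂ (-((p.1 : ℤ) + 1)) (-r₂ - 1 - p.2) = 0 := by
  have k1 : Function.Injective
      (fun p : ℕ × ℕ => (((p.2 : ℤ), -r₂ - 1 - (p.1 : ℤ)) : ℤ × ℤ)) := by
    rintro ⟨a, b⟩ ⟨c, d⟩ h
    simp only [Prod.mk.injEq] at h ⊢
    omega
  have k2 : Function.Injective
      (fun p : ℕ × ℕ => ((-((p.2 : ℤ) + 1), -r₂ - 1 - (p.1 : ℤ)) : ℤ × ℤ)) := by
    rintro ⟨a, b⟩ ⟨c, d⟩ h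
    simp only [Prod.mk.injEq] at h ⊢
    omega
  have s1 := summable_T' τ hτ r₁ r₂ _ k1
  have s2 := summable_T' τ hτ r₁ r₂ _ k2
  rw [← (Equiv.prodComm ℕ ℕ).tsum_eq, ← (Equiv.prodComm ℕ ℕ).tsum_eq
    (fun p : ℕ × ℕ => T τ r₁ r₂ (-((p.1 : ℤ) + 1)) (-r₂ - 1 - p.2))]
  simp only [Equiv.prodComm_apply, Prod.fst_swap, Prod.snd_swap]
  rw [← s1.tsum_add s2, (s1.add s2).tsum_prod]
  rw [← tsum_zero (β := ℕ)]
  refine tsum_congr fun j => ?_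
  have a1 := s1.prod_factor j
  have a2 := s2.prod_factor j
  dsimp only at a1 a2 ⊢
  rw [a1.tsum_add a2, ← theta_zero τ r₁ r₂ (-r₂ - 1 - j)]
  exact (tsum_of_nat_of_neg_add_one (f := fun n : ℤ => T τ r₁ r₂ n (-r₂ - 1 - j)) a1 a2).symm

lemma rhs_eq (τ : ℂ) (hτ : 0 < τ.im) (r₁ r₂ : ℤ) :
    ∑' n : ℕ × ℤ, varrho n.2 (n.2 + r₂) * T τ r₁ r₂ n.1 n.2
    = ∑' p : ℕ × ℕ, T τ r₁ r₂ p.1 p.2 - ∑' p : ℕ × ℕ, T τ r₁ r₂ p.1 (-r₂ - 1 - p.2) := by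
  have k0 : Function.Injective (fun p : ℕ × ℤ => (((p.1 : ℤ), p.2) : ℤ × ℤ)) := by
    rintro ⟨a, b⟩ ⟨c, d⟩ h
    simp only [Prod.mk.injEq] at h ⊢
    omega
  have s0 := summable_T' τ hτ r₁ r₂ _ k0
  have i0 : Function.Injective (fun p : ℕ × ℕ => ((p.1, (p.2 : ℤ)) : ℕ × ℤ)) := by
    rintro ⟨a, b⟩ ⟨c, d⟩ h
    simp only [Prod.mk.injEq] at h ⊢
    omega
  have i1 : Function.Injective (fun p : ℕ × ℕ => ((p.1, -r₂ - 1 - (p.2 : ℤ)) : ℕ × ℤ)) := by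
    rintro ⟨a, b⟩ ⟨c, d⟩ h
    simp only [Prod.mk.injEq] at h ⊢
    omega
  have e0 := tsum_ite_inj _ i0 (fun p => 0 ≤ p.2) (by
    rintro ⟨a, b⟩
    simp only [Set.mem_range, Prod.mk.injEq, Prod.exists]
    constructor
    · intro h; exact ⟨a, b.toNat, rfl, by omega⟩
    · rintro ⟨c, d, h1, h2⟩; omega) (fun p => T τ r₁ r₂ p.1 p.2)
  have e1 := tsum_ite_inj _ i1 (fun p => p.2 + r₂ < 0) (by
    rintro ⟨a, b⟩
    simp only [Set.mem_range, Prod.mk.injEq, Prod.exists]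
    constructor
    · intro h; exact ⟨a, (-r₂ - 1 - b).toNat, rfl, by omega⟩
    · rintro ⟨c, d, h1, h2⟩; omega) (fun p => T τ r₁ r₂ p.1 p.2)
  dsimp only at e0 e1
  rw [← e0, ← e1, ← (summable_ite _ _ s0).tsum_sub (summable_ite _ _ s0)]
  refine tsum_congr fun p => ?_
  unfold varrho
  dsimp only
  by_cases h1 : 0 ≤ p.2 <;> by_cases h2 : 0 ≤ p.2 + r₂
  · rw [if_pos h1, if_pos h2, if_pos h1, if_neg (by omega)]; ring
  · rw [if_pos h1, if_neg h2, if_pos h1, if_pos (by omega)]; ring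
  · rw [if_neg h1, if_pos h2, if_neg h1, if_neg (by omega)]; ring
  · rw [if_neg h1, if_neg h2, if_neg h1, if_pos (by omega)]; ring

end FT

/-- Proposition 3.4 of the paper: for integers r₁, r₂,
q^{-2Q(r₁,r₂)/3} G_{((r₁+r₂)/3,(2r₂-r₁)/3)}(q)
 = Σ_{n₁≥0, n₂∈ℤ} ϱ(n₂,n₂+r₂)(-1)^{n₁}
     q^{n₁(n₁+1)/2 + n₁n₂ + 2n₂² + r₁n₁ + 2r₂n₂ + 2n₂ + r₂ + 1/2}. -/
theorem stmt12 (τ : ℂ) (hτ : 0 < τ.im) (r₁ r₂ : ℤ) :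
    qpow τ (-(2 * Qform (r₁ : ℚ) (r₂ : ℚ)) / 3) *
      Gser τ (((r₁ : ℚ) + r₂) / 3) ((2 * (r₂ : ℚ) - r₁) / 3)
    = ∑' n : ℕ × ℤ, varrho n.2 (n.2 + r₂) * (-1 : ℂ) ^ n.1 *
        qpow τ ((n.1 : ℚ) * (n.1 + 1) / 2 + n.1 * n.2 + 2 * (n.2 : ℚ) ^ 2
          + r₁ * n.1 + 2 * r₂ * n.2 + 2 * n.2 + r₂ + 1/2) := by
  have h1 := FT.lhs_eq τ hτ r₁ r₂
  have h2 := FT.neg_part τ hτ r₁ r₂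
  have h3 := FT.rhs_eq τ hτ r₁ r₂
  rw [h1, eq_neg_of_add_eq_zero_right h2, ← sub_eq_add_neg, ← h3]
  refine tsum_congr fun p => ?_
  unfold FT.T FT.eex
  rw [zpow_natCast, ← mul_assoc]
  push_cast
  rfl
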